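/- Let l ≥ 2 be an integer and let N = {n_k} be a 3-lacunary sequence of positive integers. Then for every p ≥ 2, every finite sum S(x) = ∑_{m ∈ N(l)} c_m e^{2πimx} with complex coefficients satisfies ‖S‖_{L^p(0,1)} ≤ (8(p-1))^{l/2} · ‖S‖_{L^2(0,1)}. -/

import Mathlib

open MeasureTheory Filter Finset Topology

noncomputable section

/-- A sequence of positive integers is `lam`-lacunary if `n (k+1) / n k > lam` for all `k`. -/
def IsLacunary (lam : ℝ) (n : ℕ → ℕ) : Prop :=
  (∀ k, 0 < n k) ∧ ∀ k, lam * (n k : ℝ) < (n (k + 1) : ℝ)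

/-- The exponential `e^{2πimx}`. -/
def expi (m : ℤ) (x : ℝ) : ℂ := Complex.exp (2 * Real.pi * Complex.I * m * x)

/-- `N(l)`: integers of the form `ε₁ n_{k₁} + ⋯ + ε_l n_{k_l}` with `ε_j = ±1` and
`k₁ > k₂ > ⋯ > k_l`. -/
def SignedSums (n : ℕ → ℕ) (l : ℕ) : Set ℤ :=
  {m | ∃ (k : Fin l → ℕ) (ε : Fin l → ℤ),
    StrictAnti k ∧ (∀ j, ε j = 1 ∨ ε j = -1) ∧ m = ∑ j, ε j * (n (k j) : ℤ)}


theorem tp_mean (p y : ℝ) (hp : 2 ≤ p) (hy0 : 0 < y) (hy1 : y < 1) :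
    ((1+y)^(p-2) + (1-y)^(p-2))/2 ≤ (((1+y)^p + (1-y)^p)/2)^(1-2/p) := by
  have hp0 : 0 < p := by linarith
  have h1 : 0 ≤ 1 - 2/p := by
    rw [sub_nonneg, div_le_one hp0]; exact hp
  have h2 : 1 - 2/p ≤ 1 := by
    have : 0 ≤ 2/p := by positivity
    linarith
  have a0 : 0 < 1 + y := by linarith
  have b0 : 0 < 1 - y := by linarith
  have hc := (Real.concaveOn_rpow h1 h2).2
  have h := hc (x := (1+y)^p) (y := (1-y)^p) (Set.mem_Ici.2 (by positivity))
    (Set.mem_Ici.2 (by positivity)) (a := 1/2) (b := 1/2) (by norm_num) (by norm_num) (by norm_num)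
  simp only [smul_eq_mul] at h
  rw [← Real.rpow_mul a0.le, ← Real.rpow_mul b0.le] at h
  have e : p * (1 - 2/p) = p - 2 := by field_simp
  rw [e] at h
  have e2 : ((1+y)^p + (1-y)^p)/2 = 1/2*(1+y)^p + 1/2*(1-y)^p := by ring
  rw [e2]; linarith

theorem tp_one (p y : ℝ) (hp : 2 ≤ p) (hy0 : 0 ≤ y) (hy1 : y ≤ 1) :
    (((1+y)^p + (1-y)^p)/2)^(2/p) ≤ 1 + (p-1)*y^2 := by
  have hp0 : 0 < p := by linarith
  set m : ℝ → ℝ := fun y => ((1+y)^p + (1-y)^p)/2 with hm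
  set d : ℝ → ℝ := fun y => (1+y)^(p-1) - (1-y)^(p-1) with hd
  have mpos : ∀ y ∈ Set.Icc (0:ℝ) 1, 0 < m y := by
    intro y hy
    have h1 : 0 < 1 + y := by linarith [hy.1]
    have h2 : 0 ≤ 1 - y := by linarith [hy.2]
    simp only [hm]; positivity
  have mc : Continuous m := by
    simp only [hm]
    have := Real.continuous_rpow_const (q := p) hp0.le
    fun_prop
  have dc : Continuous d := by
    simp only [hd]
    have := Real.continuous_rpow_const (q := p-1) (by linarith)
    fun_prop
  have mder : ∀ y ∈ Set.Ioo (0:ℝ) 1, HasDerivAt m (p/2 * d y) y := by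
    intro y hy
    have h1 : HasDerivAt (fun y : ℝ => (1+y)^p) (1 * p * (1+y)^(p-1)) y :=
      ((hasDerivAt_id y).const_add 1).rpow_const (Or.inl (by simp; linarith [hy.1]))
    have h2 : HasDerivAt (fun y : ℝ => (1-y)^p) ((-1) * p * (1-y)^(p-1)) y :=
      ((hasDerivAt_id y).const_sub 1).rpow_const (Or.inl (by simp; linarith [hy.2]))
    refine ((h1.add h2).div_const 2).congr_deriv ?_
    simp only [hd]; ring
  have dder : ∀ y ∈ Set.Ioo (0:ℝ) 1, HasDerivAt d ((p-1) * ((1+y)^(p-2) + (1-y)^(p-2))) y := by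
    intro y hy
    have h1 : HasDerivAt (fun y : ℝ => (1+y)^(p-1)) (1 * (p-1) * (1+y)^(p-1-1)) y :=
      ((hasDerivAt_id y).const_add 1).rpow_const (Or.inl (by simp; linarith [hy.1]))
    have h2 : HasDerivAt (fun y : ℝ => (1-y)^(p-1)) ((-1) * (p-1) * (1-y)^(p-1-1)) y :=
      ((hasDerivAt_id y).const_sub 1).rpow_const (Or.inl (by simp; linarith [hy.2]))
    refine (h1.sub h2).congr_deriv ?_
    rw [show p - 1 - 1 = p - 2 by ring]; ring
  have mrc : ∀ e : ℝ, ContinuousOn (fun y => (m y)^e) (Set.Icc 0 1) := fun e =>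
    mc.continuousOn.rpow_const (fun x hx => Or.inl (mpos x hx).ne')
  set g1 : ℝ → ℝ := fun y => 2*(p-1)*y - (m y)^(2/p-1) * d y with hg1
  have g1mono : MonotoneOn g1 (Set.Icc 0 1) := by
    apply monotoneOn_of_hasDerivWithinAt_nonneg (f' := fun y => 2*(p-1) - ((p/2 * d y) * (2/p-1) * (m y)^(2/p-1-1) * d y + (m y)^(2/p-1) * ((p-1) * ((1+y)^(p-2) + (1-y)^(p-2))))) (convex_Icc 0 1)
    · exact (by fun_prop : Continuous fun y : ℝ => 2*(p-1)*y).continuousOn.sub ((mrc _).mul dc.continuousOn)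
    · intro y hy
      rw [interior_Icc] at hy
      have hmp := mpos y ⟨hy.1.le, hy.2.le⟩
      have h1 := (mder y hy).rpow_const (p := 2/p-1) (Or.inl hmp.ne')
      have h2 := ((hasDerivAt_id y).const_mul (2*(p-1))).sub (h1.mul (dder y hy))
      simp only [mul_one] at h2
      exact h2.hasDerivWithinAt
    · intro y hy
      rw [interior_Icc] at hy
      have hmp := mpos y ⟨hy.1.le, hy.2.le⟩
      have hmean := tp_mean p y hp hy.1 hy.2
      change _ ≤ (m y)^(1-2/p) at hmean
      have e1 : (m y)^(2/p-1) * (m y)^(1-2/p) = 1 := by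
        rw [← Real.rpow_add hmp]; simp
      have hpos : 0 < (m y)^(2/p-1) := Real.rpow_pos_of_pos hmp _
      have h3 : (m y)^(2/p-1) * (((1+y)^(p-2) + (1-y)^(p-2))/2) ≤ 1 := by
        exact (mul_le_mul_of_nonneg_left hmean hpos.le).trans e1.le
      have h4 : (p/2 * d y) * (2/p-1) * (m y)^(2/p-1-1) * d y ≤ 0 := by
        have h5 : 2/p - 1 ≤ 0 := by rw [sub_nonpos, div_le_one hp0]; exact hp
        have h6 : 0 ≤ p/2 * (m y)^(2/p-1-1) * (d y)^2 := by positivity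
        nlinarith
      have h7 : (p-1) * ((m y)^(2/p-1) * (((1+y)^(p-2) + (1-y)^(p-2))/2)) ≤ (p-1)*1 :=
        mul_le_mul_of_nonneg_left h3 (by linarith)
      nlinarith
  set g : ℝ → ℝ := fun y => (1 + (p-1)*y^2) - (m y)^(2/p) with hg
  have gmono : MonotoneOn g (Set.Icc 0 1) := by
    apply monotoneOn_of_hasDerivWithinAt_nonneg (f' := g1) (convex_Icc 0 1)
    · exact (by fun_prop : Continuous fun y : ℝ => 1 + (p-1)*y^2).continuousOn.sub (mrc _)
    · intro y hy
      rw [interior_Icc] at hy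
      have hmp := mpos y ⟨hy.1.le, hy.2.le⟩
      have h1 := (mder y hy).rpow_const (p := 2/p) (Or.inl hmp.ne')
      have h2 := ((((hasDerivAt_id y).pow 2).const_mul (p-1)).const_add 1).sub h1
      refine HasDerivAt.hasDerivWithinAt (h2.congr_deriv ?_)
      simp only [hg1, id]
      field_simp
      ring
    · intro y hy
      rw [interior_Icc] at hy
      have := g1mono (Set.left_mem_Icc.2 zero_le_one) ⟨hy.1.le, hy.2.le⟩ hy.1.le
      have e : g1 0 = 0 := by simp [hg1, hd]
      linarith
  have := gmono (Set.left_mem_Icc.2 zero_le_one) ⟨hy0, hy1⟩ hy0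
  have e : g 0 = 0 := by simp [hg, hm]
  rw [e] at this
  simp only [hg] at this
  linarith

/-- real two-point inequality, with `b` already multiplied by `ρ`. -/
theorem tp_real (p a b : ℝ) (hp : 2 ≤ p) (ha : 0 ≤ a) (hb : 0 ≤ b) :
    (a+b)^p + |a-b|^p ≤ 2 * (a^2 + (p-1)*b^2)^(p/2) := by
  have hp0 : 0 < p := by linarith
  have key : ∀ a b : ℝ, 0 < a → 0 ≤ b → b ≤ a →
      (a+b)^p + |a-b|^p ≤ 2 * (a^2 + (p-1)*b^2)^(p/2) := by
    intro a b ha hb hba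
    have h := tp_one p (b/a) hp (by positivity) ((div_le_one ha).2 hba)
    have h1 : 0 ≤ 1 - b/a := by rw [sub_nonneg, div_le_one ha]; exact hba
    have h0 : 0 ≤ 1 + b/a := by positivity
    have h2 := Real.rpow_le_rpow (by positivity) h (by positivity : 0 ≤ p/2)
    rw [← Real.rpow_mul (by positivity), show 2/p*(p/2) = 1 by field_simp, Real.rpow_one] at h2
    have e1 : a + b = a * (1 + b/a) := by field_simp
    have e2 : |a - b| = a * (1 - b/a) := by rw [abs_of_nonneg (by linarith)]; field_simp
    have e3 : a^2 + (p-1)*b^2 = a^2 * (1 + (p-1)*(b/a)^2) := by field_simp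
    have h3 : 0 ≤ 1 + (p-1)*(b/a)^2 := by
      have : 0 ≤ p - 1 := by linarith
      positivity
    rw [e1, e2, e3, Real.mul_rpow ha.le h0, Real.mul_rpow ha.le h1, Real.mul_rpow (by positivity) h3]
    have e4 : (a^2)^(p/2) = a^p := by
      rw [← Real.rpow_natCast, ← Real.rpow_mul ha.le]; congr 1; push_cast; field_simp
    rw [e4]
    have : 0 < a^p := by positivity
    nlinarith
  rcases le_or_gt b a with hba | hba
  · rcases ha.eq_or_lt with rfl | ha'
    · have : b = 0 := le_antisymm hba hb
      subst this
      simp [Real.zero_rpow hp0.ne', Real.zero_rpow (by positivity : p/2 ≠ 0)]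
    · exact key a b ha' hb hba
  · have h := key b a (by linarith) ha hba.le
    rw [add_comm a b, abs_sub_comm a b]
    refine h.trans ?_
    gcongr ?_ * ?_
    apply Real.rpow_le_rpow
    · have : 0 ≤ p - 1 := by linarith
      positivity
    · nlinarith [mul_nonneg (by linarith : 0 ≤ p-2) (by nlinarith : 0 ≤ b^2 - a^2)]
    · positivity

/-- monotonicity in the cross term -/
theorem conv_mono (q u s t : ℝ) (hq : 1 ≤ q) (hst : |s| ≤ t) (ht : t ≤ u) :
    (u+s)^q + (u-s)^q ≤ (u+t)^q + (u-t)^q := by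
  have ht0 : 0 ≤ t := (abs_nonneg s).trans hst
  obtain ⟨h1, h2⟩ := abs_le.1 hst
  rcases ht0.eq_or_lt with h | htp
  · have : s = 0 := by linarith
    subst this; rw [← h]
  have c := (convexOn_rpow hq).2 (x := u+t) (y := u-t) (Set.mem_Ici.2 (by linarith)) (Set.mem_Ici.2 (by linarith))
  have c1 := c (a := (t+s)/(2*t)) (b := (t-s)/(2*t)) (div_nonneg (by linarith) (by linarith)) (div_nonneg (by linarith) (by linarith)) (by field_simp; ring)
  have c2 := c (a := (t-s)/(2*t)) (b := (t+s)/(2*t)) (div_nonneg (by linarith) (by linarith)) (div_nonneg (by linarith) (by linarith)) (by field_simp; ring)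
  simp only [smul_eq_mul] at c1 c2
  have e1 : (t+s)/(2*t) * (u+t) + (t-s)/(2*t)*(u-t) = u+s := by field_simp; ring
  have e2 : (t-s)/(2*t) * (u+t) + (t+s)/(2*t)*(u-t) = u-s := by field_simp; ring
  rw [e1] at c1; rw [e2] at c2
  have e3 : (t+s)/(2*t) + (t-s)/(2*t) = 1 := by field_simp; ring
  calc _ ≤ _ := add_le_add c1 c2
    _ = ((t+s)/(2*t) + (t-s)/(2*t)) * ((u+t)^q + (u-t)^q) := by ring
    _ = _ := by rw [e3, one_mul]

theorem two_point {E : Type*} [NormedAddCommGroup E] [InnerProductSpace ℂ E] (q : ℝ) (hq : 1 ≤ q) (a b : E) :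
    (‖a+b‖^2)^q + (‖a-b‖^2)^q ≤ 2 * (‖a‖^2 + (2*q-1)*‖b‖^2)^q := by
  have h := tp_real (2*q) ‖a‖ ‖b‖ (by linarith) (norm_nonneg _) (norm_nonneg _)
  have e1 : (‖a‖+‖b‖)^(2*q) = ((‖a‖^2+‖b‖^2) + 2*‖a‖*‖b‖)^q := by
    rw [Real.rpow_mul (by positivity)]; congr 1; norm_num; ring
  have e2 : |‖a‖-‖b‖|^(2*q) = ((‖a‖^2+‖b‖^2) - 2*‖a‖*‖b‖)^q := by
    rw [Real.rpow_mul (by positivity)]; congr 1; norm_num; ring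
  rw [e1, e2, show 2*q/2 = q by ring] at h
  refine le_trans ?_ h
  have hi : |2 * RCLike.re (inner ℂ a b)| ≤ 2*‖a‖*‖b‖ := by
    rw [abs_mul, abs_two, mul_assoc]
    gcongr
    exact (RCLike.abs_re_le_norm _).trans (norm_inner_le_norm _ _)
  have := conv_mono q (‖a‖^2+‖b‖^2) _ _ hq hi (by nlinarith [sq_nonneg (‖a‖-‖b‖)])
  have f1 : ‖a+b‖^2 = ‖a‖^2+‖b‖^2 + 2 * RCLike.re (inner ℂ a b) := by
    rw [norm_add_sq (𝕜 := ℂ)]; ring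
  have f2 : ‖a-b‖^2 = ‖a‖^2+‖b‖^2 - 2 * RCLike.re (inner ℂ a b) := by
    rw [norm_sub_sq (𝕜 := ℂ)]; ring
  rw [f1, f2]; exact this

/-- fourth roots of unity -/
noncomputable def zz : Fin 4 → ℂ := ![1, Complex.I, -1, -Complex.I]

noncomputable def DD (ρ : ℝ) (s : SignType) (w : Fin 4) : ℂ :=
  if s = 0 then 1 else if s = 1 then ρ * zz w else ρ * (starRingEnd ℂ) (zz w)

theorem sum_sign {A : Type*} [AddCommMonoid A] (f : SignType → A) :
    ∑ s, f s = f 0 + f 1 + f (-1) := by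
  have : (Finset.univ : Finset SignType) = {0, 1, -1} := by decide
  rw [this, Finset.sum_insert (by decide), Finset.sum_insert (by decide), Finset.sum_singleton, add_assoc]

theorem norm_zz (w : Fin 4) : ‖zz w‖ = 1 := by
  fin_cases w <;> simp [zz]

theorem pair_step {ι : Type*} [Fintype ι] (q ρ : ℝ) (hq : 1 ≤ q) (hρ : (2*q-1)*(2*ρ^2) = 1)
    (G : ι → SignType → ℂ) (z : ℂ) (hz : ‖z‖ = 1) :
    (∑ j, ‖G j 0 + (ρ*z*G j 1 + ρ*(starRingEnd ℂ) z*G j (-1))‖^2)^q +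
      (∑ j, ‖G j 0 - (ρ*z*G j 1 + ρ*(starRingEnd ℂ) z*G j (-1))‖^2)^q ≤
      2 * (∑ j, ∑ s, ‖G j s‖^2)^q := by
  have h := two_point q hq (WithLp.toLp 2 (fun j => G j 0) : EuclideanSpace ℂ ι)
    (WithLp.toLp 2 (fun j => ρ*z*G j 1 + ρ*(starRingEnd ℂ) z*G j (-1)) : EuclideanSpace ℂ ι)
  simp only [EuclideanSpace.norm_sq_eq, PiLp.add_apply, PiLp.sub_apply] at h
  refine h.trans ?_
  gcongr ?_ * ?_
  have h2q : 0 ≤ 2*q - 1 := by linarith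
  apply Real.rpow_le_rpow (by positivity) _ (by linarith)
  simp only [sum_sign, Finset.mul_sum, ← Finset.sum_add_distrib]
  apply Finset.sum_le_sum
  intro j _
  have h1 : ‖ρ*z*G j 1 + ρ*(starRingEnd ℂ) z*G j (-1)‖ ≤ |ρ| * (‖G j 1‖ + ‖G j (-1)‖) := by
    refine (norm_add_le _ _).trans ?_
    simp [hz, mul_add]
  have h2 : ‖ρ*z*G j 1 + ρ*(starRingEnd ℂ) z*G j (-1)‖^2 ≤ (2*ρ^2) * (‖G j 1‖^2 + ‖G j (-1)‖^2) := by
    calc _ ≤ (|ρ| * (‖G j 1‖ + ‖G j (-1)‖))^2 := by gcongr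
      _ = ρ^2 * (‖G j 1‖ + ‖G j (-1)‖)^2 := by rw [mul_pow, sq_abs]
      _ ≤ ρ^2 * (2 * (‖G j 1‖^2 + ‖G j (-1)‖^2)) := by
        gcongr; nlinarith [sq_nonneg (‖G j 1‖ - ‖G j (-1)‖)]
      _ = _ := by ring
  have h3 := mul_le_mul_of_nonneg_left h2 h2q
  rw [← mul_assoc, hρ, one_mul] at h3
  linarith

theorem one_step {ι : Type*} [Fintype ι] (q ρ : ℝ) (hq : 1 ≤ q) (hρ : (2*q-1)*(2*ρ^2) = 1)
    (G : ι → SignType → ℂ) :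
    ∑ w : Fin 4, (∑ j, ‖∑ s, DD ρ s w * G j s‖^2)^q ≤ 4 * (∑ j, ∑ s, ‖G j s‖^2)^q := by
  have h0 := pair_step q ρ hq hρ G (zz 0) (norm_zz 0)
  have h1 := pair_step q ρ hq hρ G (zz 1) (norm_zz 1)
  have e2 : zz 2 = - zz 0 := by simp [zz]
  have e3 : zz 3 = - zz 1 := by simp [zz]
  have e : ∀ w j, ∑ s, DD ρ s w * G j s =
      G j 0 + (ρ*zz w*G j 1 + ρ*(starRingEnd ℂ) (zz w)*G j (-1)) := by
    intro w j
    rw [sum_sign]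
    simp [DD, add_assoc]
  have e' : ∀ w w' j, zz w' = - zz w → ∑ s, DD ρ s w' * G j s =
      G j 0 - (ρ*zz w*G j 1 + ρ*(starRingEnd ℂ) (zz w)*G j (-1)) := by
    intro w w' j h
    rw [e, h, map_neg]; ring
  rw [Fin.sum_univ_four]
  simp only [e' 0 2 _ e2, e' 1 3 _ e3, e 0, e 1]
  linarith

theorem sum_fcons {α A : Type*} [Fintype α] [AddCommMonoid A] (M : ℕ) (f : (Fin (M+1) → α) → A) :
    ∑ σ, f σ = ∑ σ' : Fin M → α, ∑ s, f (Fin.cons s σ') := by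
  rw [← (Fin.consEquiv (fun _ => α)).sum_comp, Fintype.sum_prod_type, Finset.sum_comm]
  rfl

theorem hyper (q ρ : ℝ) (hq : 1 ≤ q) (hρ : (2*q-1)*(2*ρ^2) = 1) (M : ℕ) :
    ∀ (ι : Type) [Fintype ι] (C : ι → (Fin M → SignType) → ℂ),
    ∑ ω : Fin M → Fin 4, (∑ j, ‖∑ σ, C j σ * ∏ k, DD ρ (σ k) (ω k)‖^2)^q ≤
      4^M * (∑ j, ∑ σ, ‖C j σ‖^2)^q := by
  induction M with
  | zero => intro ι _ C; simp
  | succ M ih =>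
    intro ι _ C
    have h := ih (ι × SignType) (fun j σ' => C j.1 (Fin.cons j.2 σ'))
    rw [sum_fcons]
    simp only [sum_fcons M (fun σ => ‖C _ σ‖^2), sum_fcons M (fun σ => C _ σ * _)]
    simp only [Fintype.sum_prod_type] at h
    have e : ∀ j, ∑ σ' : Fin M → SignType, ∑ s, ‖C j (Fin.cons s σ')‖^2 =
        ∑ s, ∑ σ' : Fin M → SignType, ‖C j (Fin.cons s σ')‖^2 := fun j => Finset.sum_comm
    simp only [e]
    rw [pow_succ, mul_comm ((4:ℝ)^M) 4, mul_assoc]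
    refine le_trans ?_ (mul_le_mul_of_nonneg_left h (by norm_num))
    rw [Finset.mul_sum]
    apply Finset.sum_le_sum
    intro ω' _
    refine le_trans (le_of_eq ?_) (one_step q ρ hq hρ (fun j s => ∑ σ' : Fin M → SignType, C j (Fin.cons s σ') * ∏ k, DD ρ (σ' k) (ω' k)))
    apply Finset.sum_congr rfl
    intro w _
    congr 1
    apply Finset.sum_congr rfl
    intro j _
    congr 2
    rw [Finset.sum_comm]
    apply Finset.sum_congr rfl
    intro s _
    rw [Finset.mul_sum]
    apply Finset.sum_congr rfl
    intro σ' _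
    rw [Fin.prod_univ_succ]
    simp only [Fin.cons_zero, Fin.cons_succ]
    ring

theorem hyper' (q ρ : ℝ) (hq : 1 ≤ q) (hρ : (2*q-1)*(2*ρ^2) = 1) (M : ℕ)
    (C : (Fin M → SignType) → ℂ) :
    ∑ ω : Fin M → Fin 4, (‖∑ σ, C σ * ∏ k, DD ρ (σ k) (ω k)‖^2)^q ≤
      4^M * (∑ σ, ‖C σ‖^2)^q := by
  simpa using hyper q ρ hq hρ M Unit (fun _ => C)

theorem expi_add (a b : ℤ) (x : ℝ) : expi (a+b) x = expi a x * expi b x := by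
  simp only [expi, ← Complex.exp_add]; congr 1; push_cast; ring

theorem expi_zero (x : ℝ) : expi 0 x = 1 := by simp [expi]

theorem expi_neg (a : ℤ) (x : ℝ) : expi (-a) x = (starRingEnd ℂ) (expi a x) := by
  simp only [expi, ← Complex.exp_conj]; congr 1; simp [Complex.conj_ofNat]

theorem norm_expi (a : ℤ) (x : ℝ) : ‖expi a x‖ = 1 := by
  have : (2 * Real.pi * Complex.I * a * x : ℂ) = ((2 * Real.pi * a * x : ℝ) : ℂ) * Complex.I := by
    push_cast; ring
  rw [expi, this, Complex.norm_exp_ofReal_mul_I]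

theorem expi_sum {ι : Type*} (s : Finset ι) (f : ι → ℤ) (x : ℝ) :
    expi (∑ k ∈ s, f k) x = ∏ k ∈ s, expi (f k) x := by
  classical
  induction s using Finset.induction_on with
  | empty => simp [expi_zero]
  | insert a s ha ih => rw [Finset.sum_insert ha, Finset.prod_insert ha, expi_add, ih]

theorem continuous_expi (a : ℤ) : Continuous (expi a) := by
  unfold expi; fun_prop

theorem integrable_of_cont {E : Type*} [NormedAddCommGroup E] (f : ℝ → E) (hf : Continuous f) :
    Integrable f (volume.restrict (Set.Ioo (0:ℝ) 1)) :=
  (hf.integrableOn_Icc (a := 0) (b := 1)).mono_set Set.Ioo_subset_Icc_self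

theorem integral_expi (m : ℤ) :
    ∫ x in Set.Ioo (0:ℝ) 1, expi m x = if m = 0 then 1 else 0 := by
  rw [← integral_Ioc_eq_integral_Ioo, ← intervalIntegral.integral_of_le zero_le_one]
  split_ifs with h
  · subst h; simp [expi_zero]
  · have hc : (2 * Real.pi * Complex.I * m : ℂ) ≠ 0 := by
      simp [Real.pi_ne_zero, h]
    have := integral_exp_mul_complex (a := 0) (b := 1) hc
    unfold expi
    rw [this]
    have e : Complex.exp (2 * Real.pi * Complex.I * m * (1:ℝ)) = 1 := by
      rw [Complex.exp_eq_one_iff]; exact ⟨m, by push_cast; ring⟩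
    rw [e]; simp

/-- Parseval -/
theorem parseval (F : Finset ℤ) (c : ℤ → ℂ) :
    ∫ x in Set.Ioo (0:ℝ) 1, ‖∑ m ∈ F, c m * expi m x‖^2 = ∑ m ∈ F, ‖c m‖^2 := by
  have h : ((∫ x in Set.Ioo (0:ℝ) 1, ‖∑ m ∈ F, c m * expi m x‖^2 : ℝ) : ℂ) =
      ((∑ m ∈ F, ‖c m‖^2 : ℝ) : ℂ) := by
    rw [← integral_complex_ofReal]
    have e : ∀ x : ℝ, ((‖∑ m ∈ F, c m * expi m x‖^2 : ℝ) : ℂ) =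
        ∑ m ∈ F, ∑ m' ∈ F, c m * (starRingEnd ℂ) (c m') * expi (m + -m') x := by
      intro x
      push_cast
      rw [← Complex.mul_conj', map_sum, Finset.sum_mul_sum]
      refine Finset.sum_congr rfl fun m _ => Finset.sum_congr rfl fun m' _ => ?_
      rw [expi_add, expi_neg, map_mul]; ring
    simp only [e]
    rw [integral_finsetSum _ (fun m _ => integrable_of_cont _ (by
      have := continuous_expi; fun_prop))]
    push_cast
    refine Finset.sum_congr rfl fun m hm => ?_
    rw [integral_finsetSum _ (fun m _ => integrable_of_cont _ (by
      have := continuous_expi; fun_prop))]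
    simp only [integral_const_mul, integral_expi]
    rw [Finset.sum_eq_single m]
    · simp [Complex.mul_conj']
    · intro m' _ hne
      have : m + -m' ≠ 0 := by omega
      simp [this]
    · exact fun h => absurd hm h
  exact_mod_cast h

noncomputable def KK (e : ℂ) (w : Fin 4) : ℝ := 1 + ((starRingEnd ℂ) (zz w) * e).re

theorem KK_nonneg (e : ℂ) (he : ‖e‖ = 1) (w : Fin 4) : 0 ≤ KK e w := by
  have h := Complex.abs_re_le_norm ((starRingEnd ℂ) (zz w) * e)
  simp only [norm_mul, RCLike.norm_conj, norm_zz, he, mul_one] at h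
  have := (abs_le.1 h).1
  unfold KK; linarith

noncomputable def aa (s : SignType) (w : Fin 4) : ℂ :=
  if s = 0 then 1 else if s = 1 then (starRingEnd ℂ) (zz w) / 2 else zz w / 2

theorem KK_eq (m : ℤ) (x : ℝ) (w : Fin 4) :
    (KK (expi m x) w : ℂ) = ∑ s : SignType, aa s w * expi (s * m) x := by
  rw [sum_sign]
  simp only [KK, Complex.ofReal_add, Complex.re_eq_add_conj]
  simp [aa, expi_zero, expi_neg]
  ring

theorem KK_DD (ρ : ℝ) (m : ℤ) (x : ℝ) (s : SignType) :
    ∑ w, (KK (expi m x) w : ℂ) * DD ρ s w =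
      4 * ((if s = 0 then 1 else (ρ/2 : ℂ)) * expi (s * m) x) := by
  simp only [KK, Complex.ofReal_add, Complex.re_eq_add_conj, Fin.sum_univ_four]
  have hI := Complex.I_mul_I
  rcases s with _ | _ | _
  · simp [zz, DD, expi_zero]; ring
  · simp [zz, DD, expi_neg]
    linear_combination (ρ*(expi m x) - ρ*(starRingEnd ℂ) (expi m x)) * hI
  · simp [zz, DD]
    linear_combination (ρ*(starRingEnd ℂ) (expi m x) - ρ*(expi m x)) * hI

theorem KK_sum (m : ℤ) (x : ℝ) : ∑ w, KK (expi m x) w = 4 := by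
  have h := KK_DD 1 m x 0
  simp [DD, expi_zero] at h
  exact_mod_cast h

theorem prod_KK_DD (n : ℕ → ℕ) (M : ℕ) (ρ : ℝ) (x : ℝ) (σ : Fin M → SignType) :
    ∑ ω : Fin M → Fin 4, ((∏ k : Fin M, KK (expi (n k) x) (ω k) : ℝ) : ℂ) * ∏ k, DD ρ (σ k) (ω k) =
      4^M * ((ρ/2 : ℂ)^(univ.filter (fun k => σ k ≠ 0)).card * expi (∑ k, (σ k : ℤ) * n k) x) := by
  push_cast
  simp only [← Finset.prod_mul_distrib]
  have := Finset.prod_univ_sum (fun _ : Fin M => (univ : Finset (Fin 4))) (fun k w => (KK (expi (n k) x) w : ℂ) * DD ρ (σ k) w)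
  rw [Fintype.piFinset_univ] at this
  rw [← this]
  simp only [KK_DD, Finset.prod_mul_distrib, ← expi_sum]
  simp [Finset.prod_ite, div_pow]

theorem prod_KK_sum (n : ℕ → ℕ) (M : ℕ) (x : ℝ) :
    ∑ ω : Fin M → Fin 4, (∏ k : Fin M, KK (expi (n k) x) (ω k)) = 4^M := by
  have := Finset.prod_univ_sum (fun _ : Fin M => (univ : Finset (Fin 4))) (fun k w => KK (expi (n k) x) w)
  rw [Fintype.piFinset_univ] at this
  rw [← this]
  simp [KK_sum]

theorem lac_sum (n : ℕ → ℕ) (hn : IsLacunary 3 n) (M : ℕ) :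
    2 * ∑ k ∈ range M, (n k : ℤ) < n M := by
  induction M with
  | zero => simpa using hn.1 0
  | succ M ih =>
    have h := hn.2 M
    have h' : 3 * (n M : ℤ) < n (M+1) := by exact_mod_cast h
    rw [Finset.sum_range_succ]; linarith

theorem lac_zero (n : ℕ → ℕ) (hn : IsLacunary 3 n) (M : ℕ) (d : ℕ → ℤ) (hd : ∀ k, |d k| ≤ 2)
    (h : ∑ k ∈ range M, d k * n k = 0) : ∀ k < M, d k = 0 := by
  induction M with
  | zero => simp
  | succ M ih =>
    rw [Finset.sum_range_succ] at h
    have h1 : |∑ k ∈ range M, d k * n k| ≤ 2 * ∑ k ∈ range M, (n k : ℤ) := by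
      rw [Finset.mul_sum]
      refine (Finset.abs_sum_le_sum_abs _ _).trans (Finset.sum_le_sum fun k _ => ?_)
      rw [abs_mul, Nat.abs_cast]
      gcongr
      exact hd k
    have h2 := lac_sum n hn M
    have h3 : |d M| * n M < n M := by
      have : d M * n M = - ∑ k ∈ range M, d k * n k := by linarith
      rw [← Nat.abs_cast (R := ℤ) (n M), ← abs_mul, this, abs_neg, Nat.abs_cast]
      linarith
    have h4 : d M = 0 := by
      by_contra hne
      have : 1 ≤ |d M| := Int.one_le_abs hne
      have : (0:ℤ) ≤ n M := by positivity
      nlinarith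
    rw [h4] at h
    intro k hk
    rcases Nat.lt_succ_iff_lt_or_eq.1 hk with hk | rfl
    · exact ih (by simpa using h) k hk
    · exact h4

theorem sign_inj (n : ℕ → ℕ) (hn : IsLacunary 3 n) (M : ℕ) :
    Function.Injective (fun σ : Fin M → SignType => ∑ k, (σ k : ℤ) * (n k : ℤ)) := by
  intro σ τ h
  simp only at h
  have hb : ∀ s t : SignType, |(s:ℤ) - (t:ℤ)| ≤ 2 := by decide
  have hs : ∀ s t : SignType, (s:ℤ) - (t:ℤ) = 0 → s = t := by decide
  have := lac_zero n hn M (fun k => if hk : k < M then (σ ⟨k, hk⟩ : ℤ) - τ ⟨k, hk⟩ else 0)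
    (by intro k; split_ifs; exacts [hb _ _, by simp])
    (by
      rw [Finset.sum_range]
      simp only [Fin.is_lt, dite_true, Fin.eta, sub_mul, Finset.sum_sub_distrib]
      linarith)
  funext k
  apply hs
  simpa using this k k.2

theorem integral_KK (n : ℕ → ℕ) (hn : IsLacunary 3 n) (M : ℕ) (ω : Fin M → Fin 4) :
    ∫ x in Set.Ioo (0:ℝ) 1, (∏ k : Fin M, KK (expi (n k) x) (ω k)) = 1 := by
  have h : ((∫ x in Set.Ioo (0:ℝ) 1, (∏ k : Fin M, KK (expi (n k) x) (ω k)) : ℝ) : ℂ) = 1 := by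
    rw [← integral_complex_ofReal]
    have e : ∀ x : ℝ, ((∏ k : Fin M, KK (expi (n k) x) (ω k) : ℝ) : ℂ) =
        ∑ σ : Fin M → SignType, (∏ k, aa (σ k) (ω k)) * expi (∑ k, (σ k : ℤ) * n k) x := by
      intro x
      push_cast
      simp only [KK_eq]
      rw [Finset.prod_univ_sum, Fintype.piFinset_univ]
      simp only [Finset.prod_mul_distrib, ← expi_sum]
    simp only [e]
    rw [integral_finsetSum _ (fun m _ => integrable_of_cont _ (by
      have := continuous_expi; fun_prop))]
    simp only [integral_const_mul, integral_expi]
    rw [Finset.sum_eq_single 0]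
    · simp [aa]
    · intro σ _ hne
      rw [if_neg, mul_zero]
      intro h0
      apply hne
      apply sign_inj n hn M
      simp [h0]
    · simp
  exact_mod_cast h

theorem exists_sign (n : ℕ → ℕ) (l : ℕ) (m : ℤ) (hm : m ∈ SignedSums n l) :
    ∃ M0, ∀ M ≥ M0, ∃ σ : Fin M → SignType, (univ.filter (fun k => σ k ≠ 0)).card = l ∧
      ∑ k, (σ k : ℤ) * n k = m := by
  classical
  obtain ⟨k, ε, hk, hε, rfl⟩ := hm
  have hinj : Function.Injective k := hk.injective
  set τ : ℕ → SignType := Function.extend k (fun j => SignType.sign (ε j)) 0 with hτ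
  have hτk : ∀ j, τ (k j) = SignType.sign (ε j) := fun j => hinj.extend_apply _ _ j
  have hτ0 : ∀ i, (¬ ∃ j, k j = i) → τ i = 0 := fun i hi => by
    rw [hτ, Function.extend_apply' _ _ _ hi]; rfl
  have hs : ∀ j, ((SignType.sign (ε j) : SignType) : ℤ) = ε j := by
    intro j; rcases hε j with h | h <;> simp [h]
  have hs0 : ∀ j, SignType.sign (ε j) ≠ 0 := by
    intro j; rcases hε j with h | h <;> simp [h]
  refine ⟨(univ.sup k) + 1, fun M hM => ⟨fun i => τ i, ?_, ?_⟩⟩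
  · have hlt : ∀ j, k j < M := fun j => by
      have := Finset.le_sup (f := k) (Finset.mem_univ j); omega
    have : (univ.filter (fun i : Fin M => τ i ≠ 0)) = univ.image (fun j => (⟨k j, hlt j⟩ : Fin M)) := by
      ext i
      simp only [Finset.mem_filter, Finset.mem_univ, true_and, Finset.mem_image]
      constructor
      · intro h
        by_contra hc
        apply h
        apply hτ0
        rintro ⟨j, hj⟩
        exact hc ⟨j, Fin.ext hj⟩
      · rintro ⟨j, rfl⟩
        simp only [hτk]; exact hs0 j
    rw [this, Finset.card_image_of_injective]
    · simp
    · intro a b h; exact hinj (by simpa using h)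
  · have hlt : ∀ j, k j < M := fun j => by
      have := Finset.le_sup (f := k) (Finset.mem_univ j); omega
    rw [← Finset.sum_range (fun i => (τ i : ℤ) * (n i : ℤ))]
    have hsub : univ.image k ⊆ range M := by
      intro i hi
      obtain ⟨j, _, rfl⟩ := Finset.mem_image.1 hi
      exact Finset.mem_range.2 (hlt j)
    rw [← Finset.sum_subset hsub, Finset.sum_image (fun a _ b _ h => hinj h)]
    · simp only [hτk, hs]
    · intro i _ hi
      rw [hτ0 i (by rintro ⟨j, rfl⟩; exact hi (Finset.mem_image_of_mem _ (Finset.mem_univ j)))]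
      simp

theorem main_bound (l : ℕ) (n : ℕ → ℕ) (hn : IsLacunary 3 n) (p : ℝ) (hp : 2 ≤ p)
    (F : Finset ℤ) (hF : ↑F ⊆ SignedSums n l) (c : ℤ → ℂ) :
    ∫ x in Set.Ioo (0:ℝ) 1, ‖∑ m ∈ F, c m * expi m x‖^p ≤
      ((8*(p-1))^l * ∑ m ∈ F, ‖c m‖^2)^(p/2) := by
  classical
  have hp1 : 0 < p - 1 := by linarith
  -- choose a common size
  have h1 : ∀ m : F, ∃ M0, ∀ M ≥ M0, ∃ σ : Fin M → SignType,
      (univ.filter (fun k => σ k ≠ 0)).card = l ∧ ∑ k, (σ k : ℤ) * n k = m :=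
    fun m => exists_sign n l m (hF m.2)
  choose M0 hM0 using h1
  set M := univ.sup M0 with hM
  have hσ : ∀ m ∈ F, ∃ σ : Fin M → SignType,
      (univ.filter (fun k => σ k ≠ 0)).card = l ∧ ∑ k, (σ k : ℤ) * n k = m :=
    fun m hm => hM0 ⟨m, hm⟩ M (Finset.le_sup (f := M0) (Finset.mem_univ _))
  set μ : (Fin M → SignType) → ℤ := fun σ => ∑ k, (σ k : ℤ) * n k with hμ
  have μinj : Function.Injective μ := sign_inj n hn M
  set G : Finset (Fin M → SignType) :=
    univ.filter (fun σ => (univ.filter (fun k => σ k ≠ 0)).card = l ∧ μ σ ∈ F) with hG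
  have hGF : F = G.image μ := by
    ext m
    simp only [hG, Finset.mem_image, Finset.mem_filter, Finset.mem_univ, true_and]
    constructor
    · intro hm
      obtain ⟨σ, h, h'⟩ := hσ m hm
      exact ⟨σ, ⟨h, by rw [← h'] at hm; exact hm⟩, h'⟩
    · rintro ⟨σ, ⟨_, h⟩, rfl⟩; exact h
  have sumG : ∀ {A : Type} [AddCommMonoid A] (f : ℤ → A), ∑ m ∈ F, f m = ∑ σ ∈ G, f (μ σ) := by
    intro A _ f
    conv_lhs => rw [hGF]
    exact Finset.sum_image (fun a _ b _ h => μinj h)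
  -- the parameter
  set ρ : ℝ := (Real.sqrt (2*(p-1)))⁻¹ with hρd
  have hsq : ρ^2 = (2*(p-1))⁻¹ := by
    rw [hρd, inv_pow, Real.sq_sqrt (by positivity)]
  have hρ0 : 0 < ρ := by positivity
  have hρ : (2*(p/2)-1)*(2*ρ^2) = 1 := by
    rw [hsq, show 2*(p/2)-1 = p-1 by ring]; field_simp
  have hR : (2/ρ)^2 = 8*(p-1) := by
    rw [div_pow, hsq]; field_simp; norm_num
  set C : (Fin M → SignType) → ℂ := fun σ => if σ ∈ G then ((2/ρ)^l : ℂ) * c (μ σ) else 0 with hC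
  have hCsum : ∑ σ, ‖C σ‖^2 = (8*(p-1))^l * ∑ m ∈ F, ‖c m‖^2 := by
    rw [sumG (fun m => ‖c m‖^2), Finset.mul_sum]
    rw [← Finset.sum_filter_add_sum_filter_not univ (fun σ => σ ∈ G)]
    rw [Finset.sum_eq_zero (s := univ.filter (fun σ => ¬ σ ∈ G)), add_zero]
    · rw [Finset.filter_mem_eq_inter, Finset.univ_inter]
      refine Finset.sum_congr rfl fun σ hs => ?_
      simp only [hC, if_pos hs]
      rw [← hR, norm_mul, mul_pow]
      congr 1
      simp only [norm_pow, norm_div, Complex.norm_real, Complex.norm_ofNat, Real.norm_eq_abs, abs_of_pos hρ0]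
      rw [← pow_mul, ← pow_mul, mul_comm]
    · intro σ hs
      simp [hC, (Finset.mem_filter.1 hs).2]
  set Φ : (Fin M → Fin 4) → ℂ := fun ω => ∑ σ, C σ * ∏ k, DD ρ (σ k) (ω k) with hΦ
  set K : ℝ → (Fin M → Fin 4) → ℝ := fun x ω => ∏ k : Fin M, KK (expi (n k) x) (ω k) with hK
  have K0 : ∀ x ω, 0 ≤ K x ω := fun x ω =>
    Finset.prod_nonneg fun k _ => KK_nonneg _ (norm_expi _ _) _
  have hrep : ∀ x, ∑ m ∈ F, c m * expi m x = ∑ ω, (((4^M)⁻¹ * K x ω : ℝ) : ℂ) * Φ ω := by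
    intro x
    have e1 : ∑ ω, (((4^M)⁻¹ * K x ω : ℝ) : ℂ) * Φ ω =
        ∑ σ, C σ * ((4^M)⁻¹ * ∑ ω, (K x ω : ℂ) * ∏ k, DD ρ (σ k) (ω k)) := by
      simp only [hΦ, Finset.mul_sum]
      rw [Finset.sum_comm]
      refine Finset.sum_congr rfl fun σ _ => Finset.sum_congr rfl fun ω _ => ?_
      push_cast; ring
    rw [e1, sumG (fun m => c m * expi m x)]
    simp only [hK, prod_KK_DD]
    rw [← Finset.sum_subset (Finset.subset_univ G)]
    · refine Finset.sum_congr rfl fun σ hs => ?_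
      have hl : (univ.filter (fun k => σ k ≠ 0)).card = l := (Finset.mem_filter.1 hs).2.1
      rw [hl]
      simp only [hC, if_pos hs]
      have hρc : (ρ : ℂ) ≠ 0 := by exact_mod_cast hρ0.ne'
      have e2 : ((2/ρ : ℂ))^l * (ρ/2 : ℂ)^l = 1 := by
        rw [← mul_pow, show (2/ρ : ℂ) * (ρ/2) = 1 by field_simp, one_pow]
      have e3 : ((4:ℂ)^M)⁻¹ * 4^M = 1 := inv_mul_cancel₀ (pow_ne_zero _ (by norm_num))
      linear_combination (-(c (μ σ) * expi (μ σ) x)) * e2 - (c (μ σ) * expi (μ σ) x) * ((2/ρ : ℂ))^l * (ρ/2 : ℂ)^l * e3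
    · intro σ _ hs
      simp [hC, hs]
  have hpt : ∀ x, ‖∑ m ∈ F, c m * expi m x‖^p ≤ ∑ ω, ((4^M)⁻¹ * K x ω) * ‖Φ ω‖^p := by
    intro x
    rw [hrep]
    have hw : ∀ ω ∈ (univ : Finset (Fin M → Fin 4)), 0 ≤ (4^M)⁻¹ * K x ω :=
      fun ω _ => mul_nonneg (by positivity) (K0 x ω)
    refine le_trans (Real.rpow_le_rpow (norm_nonneg _) (norm_sum_le _ _) (by linarith)) ?_
    have e : ∀ ω, ‖(((4^M)⁻¹ * K x ω : ℝ) : ℂ) * Φ ω‖ = ((4^M)⁻¹ * K x ω) * ‖Φ ω‖ := by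
      intro ω
      rw [norm_mul, Complex.norm_real, Real.norm_eq_abs, abs_of_nonneg (hw ω (Finset.mem_univ _))]
    simp only [e]
    apply Real.rpow_arith_mean_le_arith_mean_rpow _ _ _ hw _ (fun _ _ => norm_nonneg _) (by linarith)
    rw [← Finset.mul_sum]
    simp only [hK, prod_KK_sum]
    exact inv_mul_cancel₀ (by positivity)
  have Kc : ∀ ω, Continuous fun x => K x ω := by
    intro ω
    have := continuous_expi
    simp only [hK, KK]
    fun_prop
  have Sc : Continuous fun x => ‖∑ m ∈ F, c m * expi m x‖^p := by
    have := continuous_expi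
    exact Continuous.rpow_const (by fun_prop) (fun x => Or.inr (by linarith))
  have hint : ∀ ω ∈ (univ : Finset (Fin M → Fin 4)), Integrable (fun x => ((4^M)⁻¹ * K x ω) * ‖Φ ω‖^p)
      (volume.restrict (Set.Ioo (0:ℝ) 1)) := fun ω _ => integrable_of_cont _ (by
        have := Kc ω
        fun_prop)
  calc _ ≤ ∫ x in Set.Ioo (0:ℝ) 1, ∑ ω, ((4^M)⁻¹ * K x ω) * ‖Φ ω‖^p :=
        integral_mono (integrable_of_cont _ Sc) (integrable_finsetSum _ hint) hpt
    _ = (4^M)⁻¹ * ∑ ω, (‖Φ ω‖^2)^(p/2) := by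
        rw [integral_finsetSum _ hint, Finset.mul_sum]
        refine Finset.sum_congr rfl fun ω _ => ?_
        rw [integral_mul_const, integral_const_mul]
        simp only [hK]
        rw [integral_KK n hn M ω, mul_one]
        congr 1
        rw [← Real.rpow_natCast, ← Real.rpow_mul (norm_nonneg _)]; congr 1; push_cast; ring
    _ ≤ (4^M)⁻¹ * (4^M * (∑ σ, ‖C σ‖^2)^(p/2)) := by
        gcongr
        exact hyper' (p/2) ρ (by linarith) hρ M C
    _ = _ := by
        rw [hCsum, ← mul_assoc, inv_mul_cancel₀ (by positivity), one_mul]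

theorem memLp_S (F : Finset ℤ) (c : ℤ → ℂ) (r : ENNReal) :
    MemLp (fun x => ∑ m ∈ F, c m * expi m x) r (volume.restrict (Set.Ioo (0:ℝ) 1)) := by
  have := continuous_expi
  refine MemLp.of_bound (Continuous.aestronglyMeasurable (by fun_prop)) (∑ m ∈ F, ‖c m‖) ?_
  refine Filter.Eventually.of_forall fun x => (norm_sum_le _ _).trans (le_of_eq ?_)
  simp [norm_expi]

/-- **Theorem 2.** If `l ≥ 2` and `N` is a `3`-lacunary sequence, then for every `p ≥ 2`
every finite sum `S(x) = ∑_{m ∈ N(l)} c_m e^{2πimx}` satisfies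
`‖S‖_p ≤ (8(p-1))^{l/2} ‖S‖_2`. -/
theorem statement4 (l : ℕ) (hl : 2 ≤ l)
    (n : ℕ → ℕ) (hn : IsLacunary 3 n)
    (p : ℝ) (hp : 2 ≤ p)
    (F : Finset ℤ) (hF : ↑F ⊆ SignedSums n l) (c : ℤ → ℂ) :
    eLpNorm (fun x => ∑ m ∈ F, c m * expi m x) (ENNReal.ofReal p)
        (volume.restrict (Set.Ioo (0:ℝ) 1)) ≤
      ENNReal.ofReal ((8 * (p - 1)) ^ ((l : ℝ) / 2)) *
        eLpNorm (fun x => ∑ m ∈ F, c m * expi m x) 2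
          (volume.restrict (Set.Ioo (0:ℝ) 1)) := by
  have hp0 : 0 < p := by linarith
  have hb : 0 ≤ 8 * (p - 1) := by linarith
  have hmain := main_bound l n hn p hp F hF c
  have hA : 0 ≤ ∑ m ∈ F, ‖c m‖^2 := Finset.sum_nonneg fun _ _ => by positivity
  rw [(memLp_S F c _).eLpNorm_eq_integral_rpow_norm (by simpa using hp0) ENNReal.ofReal_ne_top,
    (memLp_S F c 2).eLpNorm_eq_integral_rpow_norm (by simp) (by simp),
    ENNReal.toReal_ofReal hp0.le, ← ENNReal.ofReal_mul (by positivity)]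
  apply ENNReal.ofReal_le_ofReal
  have e2 : ∫ x in Set.Ioo (0:ℝ) 1, ‖∑ m ∈ F, c m * expi m x‖ ^ (ENNReal.toReal 2) =
      ∑ m ∈ F, ‖c m‖^2 := by
    rw [← parseval]; simp
  rw [e2]
  have h := Real.rpow_le_rpow (integral_nonneg fun x => by positivity) hmain
    (inv_nonneg.2 hp0.le)
  refine h.trans (le_of_eq ?_)
  rw [← Real.rpow_mul (by positivity), show p / 2 * p⁻¹ = 1/2 by field_simp,
    Real.mul_rpow (by positivity) hA, ← Real.rpow_natCast, ← Real.rpow_mul hb]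
  congr 2
  · ring
  · simp
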